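/- For the minimal random walk with α < 1/2, the conditional variance of the martingale increments converges: E[ε_{n+1}^2 | F_n] → σ² = q(1−p)/(1−α)² almost surely, where ε_{n+1} = X_{n+1} − (q + α S_n/n). -/

import Mathlib

open MeasureTheory Filter

lemma det_aux (b m : ℕ → ℝ) (g : ℝ) (hg0 : 0 < g) (hg2 : g ≤ 2)
    (hm : Tendsto m atTop (nhds 0))
    (hrec : ∀ n : ℕ, 1 ≤ n → b (n + 1) = b n * (1 - g / (n + 1)) - g / (n + 1) * m n) :
    Tendsto b atTop (nhds 0) := by
  rw [Metric.tendsto_atTop]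
  intro e he
  obtain ⟨N, hN⟩ := (Metric.tendsto_atTop.1 hm) (e / 2) (by linarith)
  have key : ∀ n : ℕ, max N 1 ≤ n →
      |b (n + 1)| - e / 2 ≤ (1 - g / (n + 1)) * (|b n| - e / 2) ∧
      0 ≤ g / ((n : ℝ) + 1) ∧ 0 ≤ 1 - g / ((n : ℝ) + 1) := by
    intro n hn
    have hn1 : 1 ≤ n := le_trans (le_max_right _ _) hn
    have h1 := hN n (le_trans (le_max_left _ _) hn)
    rw [Real.dist_eq, sub_zero] at h1
    have hn1' : (1 : ℝ) ≤ n := by exact_mod_cast hn1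
    have hγ0 : 0 ≤ g / ((n : ℝ) + 1) := by positivity
    have hγ1 : g / ((n : ℝ) + 1) ≤ 1 := by
      rw [div_le_one (by positivity)]; linarith
    refine ⟨?_, hγ0, by linarith⟩
    rw [hrec n hn1]
    have h2 := abs_sub (b n * (1 - g / ((n : ℝ) + 1))) (g / ((n : ℝ) + 1) * m n)
    rw [abs_mul, abs_mul, abs_of_nonneg hγ0, abs_of_nonneg (by linarith : 0 ≤ 1 - g / ((n : ℝ) + 1))] at h2
    have h3 := mul_le_mul_of_nonneg_left h1.le hγ0
    linarith
  have ex : ∃ K, max N 1 ≤ K ∧ |b K| < e := by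
    by_contra hcon
    push Not at hcon
    have bd : ∀ n, max N 1 ≤ n → |b n| + (e / 2) * ∑ k ∈ Finset.range n, g / ((k : ℝ) + 1)
        ≤ |b (max N 1)| + (e / 2) * ∑ k ∈ Finset.range (max N 1), g / ((k : ℝ) + 1) := by
      intro n hn
      induction n, hn using Nat.le_induction with
      | base => exact le_rfl
      | succ n hn ih =>
        rw [Finset.sum_range_succ]
        obtain ⟨h1, h2, h3⟩ := key n hn
        have h4 := hcon n hn
        have h5 := mul_le_mul_of_nonneg_left h4 h2
        linarith
    have ht : Tendsto (fun n => ∑ k ∈ Finset.range n, (1 : ℝ) / ((k : ℝ) + 1)) atTop atTop :=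
      Real.tendsto_sum_range_one_div_nat_succ_atTop
    have ht2 := ht.const_mul_atTop (show 0 < e / 2 * g by positivity)
    obtain ⟨n, hn1, hn2⟩ := ((ht2.eventually_gt_atTop (|b (max N 1)| +
      (e / 2) * ∑ k ∈ Finset.range (max N 1), g / ((k : ℝ) + 1))).and
      (eventually_ge_atTop (max N 1))).exists
    have h1 := bd n hn2
    have h2 : ∑ k ∈ Finset.range n, g / ((k : ℝ) + 1)
      = g * ∑ k ∈ Finset.range n, (1 : ℝ) / ((k : ℝ) + 1) := by
      rw [Finset.mul_sum]; exact Finset.sum_congr rfl fun k _ => by ring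
    rw [h2] at h1
    have h3 := abs_nonneg (b n)
    linarith
  obtain ⟨K, hK, hbK⟩ := ex
  refine ⟨K, fun n hn => ?_⟩
  rw [Real.dist_eq, sub_zero]
  induction n, hn using Nat.le_induction with
  | base => exact hbK
  | succ n hn ih =>
    obtain ⟨h1, h2, h3⟩ := key n (hK.trans hn)
    have h5 := mul_le_mul_of_nonneg_left ih.le h3
    have h6 := mul_nonneg h2 he.le
    nlinarith

lemma det_conv (a D : ℕ → ℝ) (g c : ℝ) (hg0 : 0 < g) (hg2 : g ≤ 2)
    (hD : Tendsto (fun n => ∑ k ∈ Finset.range n, D k) atTop (nhds c))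
    (hrec : ∀ n : ℕ, 1 ≤ n → a (n + 1) = a n * (1 - g / (n + 1)) + D n) :
    Tendsto a atTop (nhds 0) := by
  have hm : Tendsto (fun n => ∑ k ∈ Finset.range n, D k - c) atTop (nhds 0) := by
    simpa using hD.sub_const c
  have hb := det_aux (fun n => a n - (∑ k ∈ Finset.range n, D k - c)) _ g hg0 hg2 hm (by
    intro n hn
    simp only [Finset.sum_range_succ, hrec n hn]
    ring)
  simpa using hb.add hm

lemma mart_conv {Ω : Type*} {m0 : MeasurableSpace Ω} (μ : Measure Ω) [IsProbabilityMeasure μ]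
    (F : Filtration ℕ m0) (D : ℕ → Ω → ℝ) (C : ℝ)
    (hmeas : ∀ n, StronglyMeasurable[F (n + 1)] (D n))
    (hbd : ∀ n ω, |D n ω| ≤ C / ((n : ℝ) + 1))
    (hce : ∀ n, μ[D n | F n] =ᵐ[μ] 0) :
    ∀ᵐ ω ∂μ, ∃ c, Tendsto (fun n => ∑ k ∈ Finset.range n, D k ω) atTop (nhds c) := by
  set M : ℕ → Ω → ℝ := fun n ω => ∑ k ∈ Finset.range n, D k ω with hM
  have hMs : ∀ n, M (n + 1) = M n + D n := fun n => by
    ext ω; simp [hM, Finset.sum_range_succ]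
  have hMmeas : StronglyAdapted F M := by
    intro n
    refine Finset.stronglyMeasurable_fun_sum _ fun k hk => ?_
    exact (hmeas k).mono (F.mono (by simpa using hk))
  have hMm0 : ∀ n, StronglyMeasurable (M n) := fun n => (hMmeas n).mono (F.le n)
  have hDm0 : ∀ n, StronglyMeasurable (D n) := fun n => (hmeas n).mono (F.le _)
  have hMbd : ∀ n, ∃ B, ∀ ω, |M n ω| ≤ B := by
    intro n
    refine ⟨∑ k ∈ Finset.range n, C / ((k : ℝ) + 1), fun ω => ?_⟩
    exact (Finset.abs_sum_le_sum_abs _ _).trans (Finset.sum_le_sum fun k _ => hbd k ω)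
  have hDi : ∀ n, Integrable (D n) μ := fun n =>
    .of_bound (hDm0 n).aestronglyMeasurable _ (ae_of_all _ (hbd n))
  have hMi : ∀ n, Integrable (M n) μ := fun n => by
    obtain ⟨B, hB⟩ := hMbd n
    exact .of_bound (hMm0 n).aestronglyMeasurable B (ae_of_all _ hB)
  have hMDi : ∀ n, Integrable (M n * D n) μ := fun n => by
    obtain ⟨B, hB⟩ := hMbd n
    exact (hDi n).bdd_mul (hMm0 n).aestronglyMeasurable (ae_of_all _ hB)
  have hDDi : ∀ n, Integrable (D n * D n) μ := fun n =>
    (hDi n).bdd_mul (hDm0 n).aestronglyMeasurable (ae_of_all _ (hbd n))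
  have hMMi : ∀ n, Integrable (M n * M n) μ := fun n => by
    obtain ⟨B, hB⟩ := hMbd n
    exact (hMi n).bdd_mul (hMm0 n).aestronglyMeasurable (ae_of_all _ hB)
  have hmart : Martingale M F μ := by
    refine martingale_of_condExp_sub_eq_zero_nat hMmeas hMi fun n => ?_
    rw [hMs n, add_sub_cancel_left]
    exact hce n
  have horth : ∀ n, ∫ ω, (M n * D n) ω ∂μ = 0 := by
    intro n
    rw [← integral_condExp (F.le n)]
    have h1 := condExp_mul_of_stronglyMeasurable_left (hMmeas n) (hMDi n) (hDi n)
    have h2 : μ[M n * D n | F n] =ᵐ[μ] 0 := by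
      filter_upwards [h1, hce n] with ω h1 h2
      rw [h1, Pi.mul_apply, h2]; simp
    rw [integral_congr_ae h2]; simp
  have hL2 : ∀ n, ∫ ω, (M n * M n) ω ∂μ
      ≤ ∑ k ∈ Finset.range n, C ^ 2 * (1 / ((k : ℝ) + 1) ^ 2) := by
    intro n
    induction n with
    | zero => simp [hM]
    | succ n ih =>
      rw [Finset.sum_range_succ]
      have e : M (n + 1) * M (n + 1) = M n * M n + ((M n * D n) + (M n * D n)) + D n * D n := by
        rw [hMs]; ring
      rw [e, integral_add' ((hMMi n).add ((hMDi n).add (hMDi n))) (hDDi n),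
        integral_add' (hMMi n) ((hMDi n).add (hMDi n)), integral_add' (hMDi n) (hMDi n), horth]
      have : ∫ ω, (D n * D n) ω ∂μ ≤ C ^ 2 * (1 / ((n : ℝ) + 1) ^ 2) := by
        have h := integral_mono (hDDi n) (integrable_const (C ^ 2 * (1 / ((n : ℝ) + 1) ^ 2)))
          (fun ω => by
            have h := hbd n ω
            have h2 := mul_self_le_mul_self (abs_nonneg _) h
            rw [abs_mul_abs_self] at h2
            simp only [Pi.mul_apply]
            refine h2.trans (le_of_eq ?_)
            field_simp)
        simpa using h
      linarith
  have hsum : Summable fun k : ℕ => C ^ 2 * (1 / ((k : ℝ) + 1) ^ 2) := by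
    have h := (summable_nat_add_iff 1).2 (Real.summable_one_div_nat_pow (p := 2).2 (by norm_num))
    push_cast at h
    exact h.mul_left _
  set T := ∑' k : ℕ, C ^ 2 * (1 / ((k : ℝ) + 1) ^ 2) with hT
  have hL2' : ∀ n, ∫ ω, (M n * M n) ω ∂μ ≤ T := fun n =>
    (hL2 n).trans (hsum.sum_le_tsum _ fun k _ => by positivity)
  refine hmart.submartingale.exists_ae_tendsto_of_bdd (R := Real.toNNReal (1 + T)) fun n => ?_
  rw [eLpNorm_one_eq_lintegral_enorm, ← ofReal_integral_norm_eq_lintegral_enorm (hMi n)]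
  refine ENNReal.ofReal_le_ofReal ?_
  have h := integral_mono (hMi n).norm ((integrable_const (1 : ℝ)).add (hMMi n)) (fun ω => by
    simp only [Pi.add_apply, Pi.mul_apply, Real.norm_eq_abs]
    rw [← abs_mul_abs_self (M n ω)]
    nlinarith [sq_nonneg (|M n ω| - 1 / 2)])
  rw [integral_add' (integrable_const (1 : ℝ)) (hMMi n)] at h
  have h2 := hL2' n
  simp only [integral_const, probReal_univ, one_smul] at h
  linarith

/-- For the minimal random walk with `α < 1/2`, the conditional variances of the
martingale increments converge: `E[ε_{n+1}² | F_n] → σ² = q(1−p)/(1−α)²` a.s. -/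
theorem stmt_14 {Ω : Type*} {m0 : MeasurableSpace Ω} (μ : Measure Ω) [IsProbabilityMeasure μ]
    (F : Filtration ℕ m0) (X S : ℕ → Ω → ℝ) (p q α : ℝ)
    (hp : p ∈ Set.Icc (0 : ℝ) 1) (hq : q ∈ Set.Ioc (0 : ℝ) 1) (hα : α = p - q)
    (hα2 : α < 1 / 2)
    (hX01 : ∀ n ω, X n ω = 0 ∨ X n ω = 1)
    (hS0 : ∀ ω, S 0 ω = 0)
    (hSrec : ∀ n ω, S (n + 1) ω = S n ω + X (n + 1) ω)
    (hXadapted : Adapted F X)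
    (hcond : ∀ n, 1 ≤ n →
      μ[Set.indicator {ω' | X (n + 1) ω' = 1} (fun _ => (1 : ℝ)) | F n]
        =ᵐ[μ] fun ω => q + α * S n ω / n) :
    ∀ᵐ ω ∂μ,
      Tendsto
        (fun n : ℕ =>
          (μ[fun ω' => (X (n + 1) ω' - (q + α * S n ω' / n)) ^ 2 | F n]) ω)
        atTop (nhds (q * (1 - p) / (1 - α) ^ 2)) := by
  obtain ⟨hp0, hp1⟩ := hp
  obtain ⟨hq0, hq1⟩ := hq
  have hind : ∀ n, Set.indicator {ω' | X n ω' = 1} (fun _ => (1 : ℝ)) = X n := by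
    intro n; ext ω
    rcases hX01 n ω with h | h <;> simp [Set.indicator, h]
  simp only [hind] at hcond
  have hXm : ∀ n, StronglyMeasurable[F n] (X n) := fun n => (hXadapted n).stronglyMeasurable
  have hSm : ∀ n, StronglyMeasurable[F n] (S n) := by
    intro n
    induction n with
    | zero =>
      have : S 0 = fun _ => 0 := funext hS0
      rw [this]; exact stronglyMeasurable_const
    | succ n ih =>
      have : S (n + 1) = S n + X (n + 1) := funext (hSrec n)
      rw [this]; exact (ih.mono (F.mono n.le_succ)).add (hXm _)
  have hSb : ∀ n ω, 0 ≤ S n ω ∧ S n ω ≤ n := by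
    intro n ω
    induction n with
    | zero => simp [hS0]
    | succ n ih =>
      rw [hSrec]; push_cast
      rcases hX01 (n + 1) ω with h | h <;> rw [h] <;> constructor <;> linarith [ih.1, ih.2]
  set P : ℕ → Ω → ℝ := fun n ω => q + α * S n ω / n with hP
  have hPm : ∀ n, StronglyMeasurable[F n] (P n) := fun n =>
    stronglyMeasurable_const.add ((stronglyMeasurable_const.mul (hSm n)).div
      stronglyMeasurable_const)
  have hPb : ∀ n ω, |P n ω| ≤ 2 := by
    intro n ω
    have h0 : 0 ≤ S n ω / n := div_nonneg (hSb n ω).1 n.cast_nonneg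
    have h1 : S n ω / n ≤ 1 := div_le_one_of_le₀ (hSb n ω).2 n.cast_nonneg
    have e : P n ω = q + α * (S n ω / n) := by simp only [hP]; ring
    rw [e, abs_le]
    constructor <;> nlinarith
  have hXb : ∀ n ω, |X n ω| ≤ 1 := by
    intro n ω
    rcases hX01 n ω with h | h <;> simp [h]
  have hXi : ∀ n, Integrable (X n) μ := fun n =>
    .of_bound ((hXm n).mono (F.le n)).aestronglyMeasurable 1 (ae_of_all _ (hXb n))
  have hPm0 : ∀ n, StronglyMeasurable (P n) := fun n => (hPm n).mono (F.le n)
  have hPi : ∀ n, Integrable (P n) μ := fun n =>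
    .of_bound (hPm0 n).aestronglyMeasurable 2 (ae_of_all _ (hPb n))
  -- the martingale differences
  set D : ℕ → Ω → ℝ := fun n => if n = 0 then 0 else (1 / ((n : ℝ) + 1)) • (X (n + 1) - P n) with hD
  have hconv := mart_conv μ F D 3 (by
      intro n
      by_cases h : n = 0
      · simp only [hD, h, if_true]; exact stronglyMeasurable_zero
      · simp only [hD, h, if_false]
        exact ((hXm _).sub ((hPm n).mono (F.mono n.le_succ))).const_smul _) (by
      intro n ω
      by_cases h : n = 0
      · simp [hD, h]
      · simp only [hD, h, if_false, Pi.smul_apply, Pi.sub_apply, smul_eq_mul]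
        rw [abs_mul, abs_of_nonneg (by positivity), div_mul_eq_mul_div, one_mul]
        gcongr
        have h1 := abs_sub (X (n + 1) ω) (P n ω)
        linarith [hXb (n + 1) ω, hPb n ω]) (by
      intro n
      by_cases h : n = 0
      · simp only [hD, h, if_true, condExp_zero]; rfl
      · simp only [hD, h, if_false]
        have h1 := condExp_smul (μ := μ) (1 / ((n : ℝ) + 1)) (X (n + 1) - P n) (F n)
        have h2 := condExp_sub (hXi (n + 1)) (hPi n) (F n)
        rw [condExp_of_stronglyMeasurable (F.le n) (hPm n) (hPi n)] at h2
        filter_upwards [h1, h2, hcond n (Nat.one_le_iff_ne_zero.2 h)] with ω h1 h2 h3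
        rw [h1, Pi.smul_apply, h2, Pi.sub_apply, h3]
        simp [hP])
  -- conditional variance
  have hvar : ∀ n, 1 ≤ n → μ[fun ω' => (X (n + 1) ω' - P n ω') ^ 2 | F n]
      =ᵐ[μ] fun ω => P n ω * (1 - P n ω) := by
    intro n hn
    have e : (fun ω' => (X (n + 1) ω' - P n ω') ^ 2)
        = (fun ω => 1 - 2 * P n ω) * X (n + 1) + P n * P n := by
      ext ω
      simp only [Pi.add_apply, Pi.mul_apply]
      rcases hX01 (n + 1) ω with h | h <;> rw [h] <;> ring
    have hQm : StronglyMeasurable[F n] (fun ω => 1 - 2 * P n ω) :=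
      stronglyMeasurable_const.sub (stronglyMeasurable_const.mul (hPm n))
    have hPPi : Integrable (P n * P n) μ :=
      (hPi n).bdd_mul (hPm0 n).aestronglyMeasurable (ae_of_all _ (hPb n))
    have hQXi : Integrable ((fun ω => 1 - 2 * P n ω) * X (n + 1)) μ :=
      (hXi (n + 1)).bdd_mul (c := 5) (hQm.mono (F.le n)).aestronglyMeasurable (ae_of_all _ fun ω => by
        have := abs_le.1 (hPb n ω)
        rw [Real.norm_eq_abs, abs_le]; constructor <;> linarith)
    rw [e]
    have h1 := condExp_add hQXi hPPi (F n)
    rw [condExp_of_stronglyMeasurable (F.le n) ((hPm n).mul (hPm n)) hPPi] at h1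
    have h2 := condExp_mul_of_stronglyMeasurable_left hQm hQXi (hXi (n + 1))
    filter_upwards [h1, h2, hcond n hn] with ω h1 h2 h3
    rw [h1, Pi.add_apply, h2, Pi.mul_apply, h3, Pi.mul_apply]
    simp only [hP]
    ring
  have hvar' : ∀ᵐ ω ∂μ, ∀ n, 1 ≤ n → (μ[fun ω' => (X (n + 1) ω' - P n ω') ^ 2 | F n]) ω
      = P n ω * (1 - P n ω) := by
    rw [ae_all_iff]; intro n
    by_cases hn : 1 ≤ n
    · filter_upwards [hvar n hn] with ω h _ using h
    · exact ae_of_all _ fun ω h => absurd h hn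
  filter_upwards [hconv, hvar'] with ω ⟨c, hc⟩ hv
  have hg : 0 < 1 - α := by linarith
  have ha := det_conv (fun n => S n ω / n - q / (1 - α)) (fun n => D n ω) (1 - α) c hg
    (by linarith) hc (by
      intro n hn
      have hn0 : n ≠ 0 := by omega
      have hn' : (n : ℝ) ≠ 0 := by exact_mod_cast hn0
      have hn1 : (n : ℝ) + 1 ≠ 0 := by positivity
      simp only [hD, hn0, if_false, Pi.smul_apply, Pi.sub_apply, smul_eq_mul, hP, hSrec]
      push_cast
      field_simp
      ring)
  have hS : Tendsto (fun n : ℕ => S n ω / n) atTop (nhds (q / (1 - α))) := by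
    simpa using ha.add_const (q / (1 - α))
  have hPt : Tendsto (fun n => P n ω) atTop (nhds (q / (1 - α))) := by
    have h := (hS.const_mul α).const_add q
    have e : q + α * (q / (1 - α)) = q / (1 - α) := by field_simp; ring
    rw [e] at h
    refine h.congr fun n => ?_
    simp only [hP]; ring
  have hfin := hPt.mul (hPt.const_sub 1)
  have e : q / (1 - α) * (1 - q / (1 - α)) = q * (1 - p) / (1 - α) ^ 2 := by
    have : p = α + q := by linarith
    rw [this]; field_simp; ring
  rw [e] at hfin
  refine hfin.congr' ?_
  filter_upwards [eventually_ge_atTop 1] with n hn using (hv n hn).symm
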